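/- If P and Q are homogeneous real polynomials in m variables such that N(P) and N(Q) are Lorentzian, then N(PQ) is Lorentzian, where N denotes the normalization operator dividing the coefficient of w^α by α!. -/

import Mathlib

open MvPolynomial

/-- The normalization `N(Σ c_α w^α) = Σ (c_α/α!) w^α` of a polynomial. -/
noncomputable def normalizePoly {m : ℕ} (P : MvPolynomial (Fin m) ℝ) :
    MvPolynomial (Fin m) ℝ :=
  ∑ α ∈ P.support, monomial α (P.coeff α / ∏ i, ((α i).factorial : ℝ))

/-- M-convexity of a set of exponent vectors. -/
def MConvexSupport {m : ℕ} (S : Set (Fin m →₀ ℕ)) : Prop :=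
  ∀ α ∈ S, ∀ β ∈ S, ∀ i : Fin m, β i < α i →
    ∃ j : Fin m, α j < β j ∧
      (α - Finsupp.single i 1 + Finsupp.single j 1) ∈ S ∧
      (β - Finsupp.single j 1 + Finsupp.single i 1) ∈ S

/-- Iterated partial derivative `∂^γ = ∂_1^{γ_1} ⋯ ∂_m^{γ_m}`. -/
noncomputable def pderivMulti {m : ℕ} (γ : Fin m → ℕ) (P : MvPolynomial (Fin m) ℝ) :
    MvPolynomial (Fin m) ℝ :=
  (List.finRange m).foldr (fun i Q => (fun R => pderiv i R)^[γ i] Q) P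

/-- The Hessian matrix of a polynomial (constant terms of the second derivatives;
for a quadratic form this is the usual Hessian). -/
noncomputable def hess {m : ℕ} (P : MvPolynomial (Fin m) ℝ) : Matrix (Fin m) (Fin m) ℝ :=
  Matrix.of fun i j => MvPolynomial.coeff 0 (pderiv i (pderiv j P))

/-- A real symmetric matrix has at most one positive eigenvalue. -/
def AtMostOnePosEigenvalue {m : ℕ} (M : Matrix (Fin m) (Fin m) ℝ) : Prop :=
  ∀ hM : M.IsHermitian, (Finset.univ.filter fun i => 0 < hM.eigenvalues i).card ≤ 1

/-- A homogeneous polynomial of degree `d` is Lorentzian (Brändén–Huh): it has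
nonnegative coefficients, M-convex support, and all its `(d-2)`-fold partial
derivatives are quadratics whose Hessians have at most one positive eigenvalue. -/
def Lorentzian {m : ℕ} (d : ℕ) (P : MvPolynomial (Fin m) ℝ) : Prop :=
  P.IsHomogeneous d ∧ (∀ α, 0 ≤ P.coeff α) ∧
  MConvexSupport {α | P.coeff α ≠ 0} ∧
  ∀ γ : Fin m → ℕ, (∑ i, γ i) = d - 2 →
    AtMostOnePosEigenvalue (hess (pderivMulti γ P))


section QuadraticForms

open Matrix

variable {σ : Type*} [Fintype σ]

/-- The bilinear form of a matrix. -/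
def bil (A : Matrix σ σ ℝ) (u v : σ → ℝ) : ℝ := u ⬝ᵥ A *ᵥ v

lemma bil_add_left (A : Matrix σ σ ℝ) (u v w : σ → ℝ) :
    bil A (u + v) w = bil A u w + bil A v w := by
  simp [bil, add_dotProduct]

lemma bil_add_right (A : Matrix σ σ ℝ) (u v w : σ → ℝ) :
    bil A u (v + w) = bil A u v + bil A u w := by
  simp [bil, mulVec_add]

lemma bil_smul_left (A : Matrix σ σ ℝ) (c : ℝ) (u v : σ → ℝ) :
    bil A (c • u) v = c * bil A u v := by
  simp [bil, smul_dotProduct]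

lemma bil_smul_right (A : Matrix σ σ ℝ) (c : ℝ) (u v : σ → ℝ) :
    bil A u (c • v) = c * bil A u v := by
  simp [bil, mulVec_smul]

lemma bil_eq_sum (A : Matrix σ σ ℝ) (u v : σ → ℝ) :
    bil A u v = ∑ i, ∑ j, u i * v j * A i j := by
  simp only [bil, dotProduct, mulVec, Finset.mul_sum]
  exact Finset.sum_congr rfl fun i _ => Finset.sum_congr rfl fun j _ => by ring

lemma bil_single_left [DecidableEq σ] (A : Matrix σ σ ℝ) (i : σ) (v : σ → ℝ) :
    bil A (Pi.single i 1) v = ∑ j, A i j * v j := by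
  simp [bil, mulVec, dotProduct, Pi.single_apply]

lemma bil_comm {A : Matrix σ σ ℝ} (hA : A.IsSymm) (u v : σ → ℝ) :
    bil A u v = bil A v u := by
  rw [bil_eq_sum, bil_eq_sum, Finset.sum_comm]
  exact Finset.sum_congr rfl fun i _ => Finset.sum_congr rfl fun j _ => by
    rw [hA.apply]; ring

lemma bil_combination {A : Matrix σ σ ℝ} (hA : A.IsSymm) (a b : ℝ) (u v : σ → ℝ) :
    bil A (a • u + b • v) (a • u + b • v) =
      a ^ 2 * bil A u u + 2 * a * b * bil A u v + b ^ 2 * bil A v v := by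
  simp only [bil_add_left, bil_add_right, bil_smul_left, bil_smul_right, bil_comm hA v u]
  ring

/-- The quadratic form of the matrix is positive definite on no plane. -/
def NoPosPlane (A : Matrix σ σ ℝ) : Prop :=
  ∀ u v : σ → ℝ, ∃ a b : ℝ, (a ≠ 0 ∨ b ≠ 0) ∧ bil A (a • u + b • v) (a • u + b • v) ≤ 0

lemma noPosPlane_of_hyperplane {A : Matrix σ σ ℝ} (φ : (σ → ℝ) → ℝ)
    (hφ : ∀ a b u v, φ (a • u + b • v) = a * φ u + b * φ v)
    (h : ∀ t, φ t = 0 → bil A t t ≤ 0) : NoPosPlane A := by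
  intro u v
  by_cases hu : φ u = 0
  · exact ⟨1, 0, by simp, h _ (by rw [hφ, hu]; ring)⟩
  · exact ⟨φ v, -φ u, by simp [hu], h _ (by rw [hφ]; ring)⟩

lemma noPosPlane_of_nonpos {A : Matrix σ σ ℝ} (h : ∀ t, bil A t t ≤ 0) : NoPosPlane A :=
  fun _ _ => ⟨1, 0, by simp, h _⟩

lemma NoPosPlane.nonpos_of_pos {A : Matrix σ σ ℝ} (h : NoPosPlane A) (hA : A.IsSymm)
    {e t : σ → ℝ} (he : 0 < bil A e e) (het : bil A e t = 0) : bil A t t ≤ 0 := by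
  by_contra! ht
  obtain ⟨a, b, hab, hle⟩ := h e t
  rw [bil_combination hA, het] at hle
  rcases hab with ha | hb
  · have := mul_pos (pow_pos (abs_pos.2 ha) 2) he
    rw [sq_abs] at this
    nlinarith [mul_nonneg (sq_nonneg b) ht.le]
  · have := mul_pos (pow_pos (abs_pos.2 hb) 2) ht
    rw [sq_abs] at this
    nlinarith [mul_nonneg (sq_nonneg a) he.le]

/-- If `A` has no positive plane and `bil A e` is a nonzero functional with `bil A e e ≥ 0`, then
the form is nonpositive on the orthogonal hyperplane of `e`. -/
lemma NoPosPlane.nonpos_of_orthogonal {A : Matrix σ σ ℝ} (h : NoPosPlane A) (hA : A.IsSymm)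
    {e p t : σ → ℝ} (he : 0 ≤ bil A e e) (hp : bil A e p ≠ 0) (het : bil A e t = 0) :
    bil A t t ≤ 0 := by
  by_contra! ht
  -- A vector `f` with `bil A f f > 0` and `bil A f t = 0`.
  set f : σ → ℝ := bil A t t • p + (-bil A t p) • t with hf
  have hft : bil A t f = 0 := by
    simp only [hf, bil_add_right, bil_smul_right]; ring
  have hef : bil A e f ≠ 0 := by
    simp only [hf, bil_add_right, bil_smul_right, het]
    simp [hp, ht.ne']
  have key : ∀ r : ℝ, bil A (r • e + (1 : ℝ) • f) (r • e + (1 : ℝ) • f) ≤ 0 := by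
    intro r
    refine h.nonpos_of_pos hA ht ?_
    rw [bil_add_right, bil_smul_right, bil_smul_right, hft, bil_comm hA t e, het]; ring
  have hk := key ((1 + |bil A f f|) / bil A e f)
  rw [bil_combination hA] at hk
  have h1 : 2 * ((1 + |bil A f f|) / bil A e f) * 1 * bil A e f = 2 * (1 + |bil A f f|) := by
    field_simp
  rw [h1] at hk
  have h2 := mul_nonneg (sq_nonneg ((1 + |bil A f f|) / bil A e f)) he
  have h3 := neg_abs_le (bil A f f)
  have h4 := abs_nonneg (bil A f f)
  nlinarith

lemma atMostOnePosEigenvalue_iff {m : ℕ} {M : Matrix (Fin m) (Fin m) ℝ} (hs : M.IsSymm) :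
    AtMostOnePosEigenvalue M ↔ NoPosPlane M := by
  have hM : M.IsHermitian := by
    rw [IsHermitian, conjTranspose_eq_transpose_of_trivial]; exact hs
  set e : Fin m → Fin m → ℝ := fun i => (hM.eigenvectorBasis i).ofLp with he
  have hev : ∀ i, M *ᵥ e i = hM.eigenvalues i • e i := hM.mulVec_eigenvectorBasis
  have hdot : ∀ i j, e i ⬝ᵥ e j = if i = j then 1 else 0 := by
    intro i j
    have := orthonormal_iff_ite.1 hM.eigenvectorBasis.orthonormal i j
    rw [← this, EuclideanSpace.inner_eq_star_dotProduct]
    simp [he, dotProduct_comm]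
  have hexp : ∀ t : Fin m → ℝ, t = ∑ i, (e i ⬝ᵥ t) • e i := by
    intro t
    have := congrArg WithLp.ofLp (hM.eigenvectorBasis.sum_repr' (WithLp.toLp 2 t))
    simp only [WithLp.ofLp_sum, WithLp.ofLp_smul] at this
    conv_lhs => rw [← this]
    refine Finset.sum_congr rfl fun i _ => ?_
    rw [EuclideanSpace.inner_eq_star_dotProduct]
    simp [he, dotProduct_comm]
  have hquad : ∀ t : Fin m → ℝ, bil M t t = ∑ i, hM.eigenvalues i * (e i ⬝ᵥ t) ^ 2 := by
    intro t
    have h1 : M *ᵥ t = ∑ i, (e i ⬝ᵥ t * hM.eigenvalues i) • e i := by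
      conv_lhs => rw [hexp t]
      rw [mulVec_sum]
      exact Finset.sum_congr rfl fun i _ => by rw [mulVec_smul, hev, smul_smul]
    rw [bil, h1, dotProduct_sum]
    refine Finset.sum_congr rfl fun i _ => ?_
    rw [dotProduct_smul, dotProduct_comm t, smul_eq_mul]; ring
  constructor
  · intro h
    have hcard := Finset.card_le_one.1 (h hM)
    simp only [Finset.mem_filter, Finset.mem_univ, true_and] at hcard
    by_cases hex : ∃ i, 0 < hM.eigenvalues i
    · obtain ⟨i, hi⟩ := hex
      refine noPosPlane_of_hyperplane (fun t => e i ⬝ᵥ t) ?_ ?_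
      · intro a b u v; simp [dotProduct_add, dotProduct_smul]
      · intro t ht
        rw [hquad]
        refine Finset.sum_nonpos fun j _ => ?_
        by_cases hj : 0 < hM.eigenvalues j
        · rw [hcard j hj i hi]
          simp [show e i ⬝ᵥ t = 0 from ht]
        · exact mul_nonpos_of_nonpos_of_nonneg (not_lt.1 hj) (sq_nonneg _)
    · push Not at hex
      refine noPosPlane_of_nonpos fun t => ?_
      rw [hquad]
      exact Finset.sum_nonpos fun j _ => mul_nonpos_of_nonpos_of_nonneg (hex j) (sq_nonneg _)
  · intro h hM'
    refine Finset.card_le_one.2 fun i hi j hj => ?_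
    simp only [Finset.mem_filter, Finset.mem_univ, true_and] at hi hj
    by_contra hij
    have hb : ∀ k l, bil M (e k) (e l) = if k = l then hM.eigenvalues l else 0 := by
      intro k l
      rw [bil, hev, dotProduct_smul, hdot]; simp
    obtain ⟨a, b, hab, hle⟩ := h (e i) (e j)
    rw [bil_combination hs, hb, hb, hb] at hle
    simp only [hij, if_true, if_false] at hle
    rcases hab with ha | hb
    · have := mul_pos (pow_pos (abs_pos.2 ha) 2) hi
      rw [sq_abs] at this
      nlinarith [mul_nonneg (sq_nonneg b) hj.le]
    · have := mul_pos (pow_pos (abs_pos.2 hb) 2) hj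
      rw [sq_abs] at this
      nlinarith [mul_nonneg (sq_nonneg a) hi.le]

end QuadraticForms

section Merging

open Matrix

/-- Solvability of a linear recursion with boundary conditions, by counting dimensions. -/
lemma exists_boundary_recursion {c r : ℕ} (p q f g : ℕ → ℝ) (μ ν : ℝ)
    (hp : ∀ k < r, p k ≠ 0) (hq : ∀ k, r < k → k ≤ c → q k ≠ 0) :
    ∃ (a b : ℝ) (X : ℕ → ℝ), (a ≠ 0 ∨ b ≠ 0) ∧ X 0 = 0 ∧ X (c + 1) = a * μ + b * ν ∧
      ∀ k ≤ c, a * f k + b * g k + X (k + 1) * p k + (a * μ + b * ν - X k) * q k = 0 := by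
  let L : (Fin (c + 2) → ℝ) × (ℝ × ℝ) →ₗ[ℝ] (Fin (c + 1) → ℝ) × (ℝ × ℝ) :=
    { toFun := fun w =>
        (fun k => w.2.1 * f k + w.2.2 * g k + w.1 k.succ * p k +
            (w.2.1 * μ + w.2.2 * ν - w.1 k.castSucc) * q k,
          (w.1 0, w.1 (Fin.last _) - (w.2.1 * μ + w.2.2 * ν)))
      map_add' := by
        intro w z
        ext <;> simp <;> ring
      map_smul' := by
        intro t w
        ext <;> simp <;> ring }
  have hker : L.ker ≠ ⊥ := by
    apply LinearMap.ker_ne_bot_of_finrank_lt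
    simp
  obtain ⟨w, hw, hw0⟩ := (Submodule.ne_bot_iff _).1 hker
  rw [LinearMap.mem_ker] at hw
  set X : ℕ → ℝ := fun n => if h : n < c + 2 then w.1 ⟨n, h⟩ else 0 with hX
  have e1 : ∀ k ≤ c, w.2.1 * f k + w.2.2 * g k + X (k + 1) * p k +
      (w.2.1 * μ + w.2.2 * ν - X k) * q k = 0 := by
    intro k hk
    have := congrFun (congrArg Prod.fst hw) ⟨k, by omega⟩
    simp only [hX, show k + 1 < c + 2 by omega, show k < c + 2 by omega, dif_pos]
    exact this
  have e2 : X 0 = 0 := by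
    have := congrArg (fun z => z.2.1) hw
    simp only [hX, show 0 < c + 2 by omega, dif_pos]
    exact this
  have e3 : X (c + 1) = w.2.1 * μ + w.2.2 * ν := by
    have : w.1 (Fin.last _) - (w.2.1 * μ + w.2.2 * ν) = 0 := congrArg (fun z => z.2.2) hw
    simp only [hX, show c + 1 < c + 2 by omega, dif_pos]
    exact sub_eq_zero.1 this
  refine ⟨w.2.1, w.2.2, X, ?_, e2, e3, e1⟩
  by_contra! hab
  obtain ⟨ha, hb⟩ := hab
  simp only [ha, hb, zero_mul, zero_add, zero_sub] at e1 e3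
  have fwd : ∀ k, k ≤ r → k ≤ c + 1 → X k = 0 := by
    intro k
    induction k with
    | zero => intro _ _; exact e2
    | succ k ih =>
      intro hk hk'
      have := e1 k (by omega)
      rw [ih (by omega) (by omega)] at this
      simpa [hp k (by omega)] using this
  have bwd : ∀ j k, k + j = c + 1 → r < k → X k = 0 := by
    intro j
    induction j with
    | zero => intro k hk _; rw [show k = c + 1 by omega, e3]
    | succ j ih =>
      intro k hk hk'
      have := e1 k (by omega)
      rw [ih (k + 1) (by omega) (by omega)] at this
      simpa [hq k hk' (by omega)] using this
  apply hw0
  refine Prod.ext (funext fun k => ?_) (Prod.ext ha hb)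
  have hXk : X k = 0 := by
    rcases le_or_gt (k : ℕ) r with h | h
    · exact fwd k h (by omega)
    · exact bwd (c + 1 - k) k (by omega) h
  simpa [hX] using hXk

variable {σ : Type*} [DecidableEq σ]

/-- The vector `t` with the entries at `x` and `y` replaced by zero. -/
def dropTwo (x y : σ) (t : σ → ℝ) : σ → ℝ := fun j => if j = x ∨ j = y then 0 else t j

lemma dropTwo_combination (x y : σ) (a b : ℝ) (u v : σ → ℝ) :
    dropTwo x y (a • u + b • v) = a • dropTwo x y u + b • dropTwo x y v := by
  ext j
  by_cases h : j = x ∨ j = y <;> simp [dropTwo, h]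

lemma eq_dropTwo_add {x y : σ} (hxy : x ≠ y) (t : σ → ℝ) :
    t = dropTwo x y t + t x • Pi.single x 1 + t y • Pi.single y 1 := by
  ext j
  by_cases hx : j = x
  · subst hx; simp [dropTwo, hxy]
  · by_cases hy : j = y
    · subst hy; simp [dropTwo, hx]
    · simp [dropTwo, hx, hy]

variable [Fintype σ]

/-- The matrix `M` arises from the sequence of matrices `A k`, `k ≤ c`, by merging the index `y`
into the index `x`; consecutive matrices share the row `R`. -/
structure IsMerge (x y : σ) (c : ℕ) (A : ℕ → Matrix σ σ ℝ) (R : ℕ → σ → ℝ) (h : ℕ → ℝ)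
    (M : Matrix σ σ ℝ) : Prop where
  ne : x ≠ y
  symm : ∀ k ≤ c, (A k).IsSymm
  row_left : ∀ k ≤ c, ∀ j, A k x j = R (k + 1) j
  row_right : ∀ k ≤ c, ∀ j, A k y j = R k j
  shared_left : ∀ k ≤ c + 1, R k x = h (k + 1)
  shared_right : ∀ k ≤ c + 1, R k y = h k
  merged_symm : M.IsSymm
  merged : ∀ i j, i ≠ x → i ≠ y → j ≠ x → j ≠ y → M i j = ∑ k ∈ Finset.range (c + 1), A k i j
  merged_row : ∀ j, j ≠ x → j ≠ y → M x j = ∑ k ∈ Finset.range (c + 2), R k j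
  merged_diag : M x x = ∑ k ∈ Finset.range (c + 3), h k
  merged_zero : ∀ j, M y j = 0

namespace IsMerge

variable {x y : σ} {c : ℕ} {A : ℕ → Matrix σ σ ℝ} {R : ℕ → σ → ℝ} {h : ℕ → ℝ} {M : Matrix σ σ ℝ}

lemma bil_add_single (H : IsMerge x y c A R h M) {k : ℕ} (hk : k ≤ c) (t : σ → ℝ) (X Y : ℝ) :
    bil (A k) (t + X • Pi.single x 1 + Y • Pi.single y 1)
        (t + X • Pi.single x 1 + Y • Pi.single y 1) =
      bil (A k) t t + 2 * X * (∑ j, R (k + 1) j * t j) + 2 * Y * (∑ j, R k j * t j) +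
        X ^ 2 * h (k + 2) + 2 * X * Y * h (k + 1) + Y ^ 2 * h k := by
  have hx : ∀ v, bil (A k) (Pi.single x 1) v = ∑ j, R (k + 1) j * v j := fun v => by
    rw [bil_single_left]; exact Finset.sum_congr rfl fun j _ => by rw [H.row_left k hk]
  have hy : ∀ v, bil (A k) (Pi.single y 1) v = ∑ j, R k j * v j := fun v => by
    rw [bil_single_left]; exact Finset.sum_congr rfl fun j _ => by rw [H.row_right k hk]
  have hxx : ∑ j, R (k + 1) j * (Pi.single x 1 : σ → ℝ) j = h (k + 2) := by
    simp [Pi.single_apply, H.shared_left (k + 1) (by omega)]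
  have hxy : ∑ j, R (k + 1) j * (Pi.single y 1 : σ → ℝ) j = h (k + 1) := by
    simp [Pi.single_apply, H.shared_right (k + 1) (by omega)]
  have hyx : ∑ j, R k j * (Pi.single x 1 : σ → ℝ) j = h (k + 1) := by
    simp [Pi.single_apply, H.shared_left k (by omega)]
  have hyy : ∑ j, R k j * (Pi.single y 1 : σ → ℝ) j = h k := by
    simp [Pi.single_apply, H.shared_right k (by omega)]
  simp only [bil_add_left, bil_add_right, bil_smul_left, bil_smul_right,
    bil_comm (H.symm k hk) t (Pi.single _ 1), hx, hy, hxx, hxy, hyx, hyy]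
  ring

lemma bil_dropTwo (H : IsMerge x y c A R h M) (t : σ → ℝ) :
    bil M (dropTwo x y t) (dropTwo x y t) =
      ∑ k ∈ Finset.range (c + 1), bil (A k) (dropTwo x y t) (dropTwo x y t) := by
  simp only [bil_eq_sum]
  symm
  rw [Finset.sum_comm]
  refine Finset.sum_congr rfl fun i _ => ?_
  rw [Finset.sum_comm]
  refine Finset.sum_congr rfl fun j _ => ?_
  by_cases hi : i = x ∨ i = y
  · simp [dropTwo, hi]
  by_cases hj : j = x ∨ j = y
  · simp [dropTwo, hj]
  push Not at hi hj
  rw [H.merged i j hi.1 hi.2 hj.1 hj.2, Finset.mul_sum]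

lemma bil_merged (H : IsMerge x y c A R h M) (t : σ → ℝ) :
    bil M t t = ∑ k ∈ Finset.range (c + 1), bil (A k) (dropTwo x y t) (dropTwo x y t) +
      2 * t x * (∑ k ∈ Finset.range (c + 2), ∑ j, R k j * dropTwo x y t j) +
      t x ^ 2 * ∑ k ∈ Finset.range (c + 3), h k := by
  have hy : ∀ v, bil M (Pi.single y 1) v = 0 := fun v => by
    rw [bil_single_left]; simp [H.merged_zero]
  have hx : bil M (Pi.single x 1) (dropTwo x y t) =
      ∑ k ∈ Finset.range (c + 2), ∑ j, R k j * dropTwo x y t j := by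
    rw [bil_single_left, Finset.sum_comm]
    refine Finset.sum_congr rfl fun j _ => ?_
    by_cases hj : j = x ∨ j = y
    · simp [dropTwo, hj]
    push Not at hj
    rw [H.merged_row j hj.1 hj.2, Finset.sum_mul]
  have hxx : bil M (Pi.single x 1) (Pi.single x 1) = ∑ k ∈ Finset.range (c + 3), h k := by
    rw [bil_single_left, ← H.merged_diag]; simp [Pi.single_apply]
  conv_lhs => rw [eq_dropTwo_add H.ne t]
  simp only [bil_add_left, bil_add_right, bil_smul_left, bil_smul_right,
    bil_comm H.merged_symm (dropTwo x y t) (Pi.single _ 1),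
    bil_comm H.merged_symm (Pi.single x 1) (Pi.single y 1), hx, hy, hxx, H.bil_dropTwo]
  ring

lemma bil_merged_add_sum_sq (H : IsMerge x y c A R h M) (t : σ → ℝ) (X : ℕ → ℝ)
    (h0 : X 0 = 0) (hc : X (c + 1) = t x) :
    bil M t t + ∑ k ∈ Finset.range (c + 1), h (k + 1) * (X (k + 1) - X k) ^ 2 =
      ∑ k ∈ Finset.range (c + 1),
        bil (A k) (dropTwo x y t + X (k + 1) • Pi.single x 1 + (t x - X k) • Pi.single y 1)
          (dropTwo x y t + X (k + 1) • Pi.single x 1 + (t x - X k) • Pi.single y 1) := by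
  have key : ∀ (B l : ℕ → ℝ) (s : ℝ) (n : ℕ),
      ∑ k ∈ Finset.range n, (B k + 2 * X (k + 1) * l (k + 1) + 2 * (s - X k) * l k +
        X (k + 1) ^ 2 * h (k + 2) + 2 * X (k + 1) * (s - X k) * h (k + 1) + (s - X k) ^ 2 * h k) =
      ∑ k ∈ Finset.range n, B k + 2 * s * ∑ k ∈ Finset.range n, l k + 2 * X n * l n +
        s ^ 2 * ∑ k ∈ Finset.range n, h k + X n ^ 2 * h (n + 1) + 2 * s * h n * X n -
        h n * X n ^ 2 + ∑ k ∈ Finset.range n, h (k + 1) * (X (k + 1) - X k) ^ 2 := by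
    intro B l s n
    induction n with
    | zero => simp [h0]
    | succ n ih => simp only [Finset.sum_range_succ, ih]; ring
  have hsum := key (fun k => bil (A k) (dropTwo x y t) (dropTwo x y t))
    (fun k => ∑ j, R k j * dropTwo x y t j) (t x) (c + 1)
  rw [hc] at hsum
  rw [H.bil_merged, Finset.sum_congr rfl fun k hk =>
    H.bil_add_single (Nat.lt_succ_iff.1 (Finset.mem_range.1 hk)) _ _ _, hsum,
    Finset.sum_range_succ _ (c + 1 + 1), Finset.sum_range_succ h (c + 1),
    Finset.sum_range_succ _ (c + 1)]
  ring

lemma bil_merged_le (H : IsMerge x y c A R h M) (hh : ∀ k, 0 ≤ h k) (t : σ → ℝ) (X : ℕ → ℝ)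
    (h0 : X 0 = 0) (hc : X (c + 1) = t x)
    (hle : ∀ k ≤ c, bil (A k)
      (dropTwo x y t + X (k + 1) • Pi.single x 1 + (t x - X k) • Pi.single y 1)
      (dropTwo x y t + X (k + 1) • Pi.single x 1 + (t x - X k) • Pi.single y 1) ≤ 0) :
    bil M t t ≤ 0 := by
  have h1 := H.bil_merged_add_sum_sq t X h0 hc
  have h2 : 0 ≤ ∑ k ∈ Finset.range (c + 1), h (k + 1) * (X (k + 1) - X k) ^ 2 :=
    Finset.sum_nonneg fun k _ => mul_nonneg (hh _) (sq_nonneg _)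
  have h3 := Finset.sum_nonpos fun k (hk : k ∈ Finset.range (c + 1)) =>
    hle k (Nat.lt_succ_iff.1 (Finset.mem_range.1 hk))
  linarith

/-- The case in which some index separates the matrices whose row `x` vanishes from those
whose row `y` vanishes. -/
lemma noPosPlane (H : IsMerge x y c A R h M) (hA : ∀ k ≤ c, NoPosPlane (A k))
    (hA0 : ∀ k ≤ c, ∀ i j, 0 ≤ A k i j) (hh : ∀ k, 0 ≤ h k) {r : ℕ} (hr : r ≤ c)
    (hlt : ∀ k < r, A k = 0 ∨ R (k + 1) ≠ 0)
    (hgt : ∀ k, r < k → k ≤ c → A k = 0 ∨ R k ≠ 0) : NoPosPlane M := by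
  classical
  intro u v
  have hR0 : ∀ k ≤ c, ∀ j, 0 ≤ R (k + 1) j := fun k hk j => H.row_left k hk j ▸ hA0 k hk x j
  have hR0' : ∀ k ≤ c, ∀ j, 0 ≤ R k j := fun k hk j => H.row_right k hk j ▸ hA0 k hk y j
  have sum_ne : ∀ w : σ → ℝ, (∀ j, 0 ≤ w j) → w ≠ 0 → ∑ j, w j ≠ 0 := by
    intro w hw hne h0
    exact hne (funext fun j =>
      (Finset.sum_eq_zero_iff_of_nonneg fun j _ => hw j).1 h0 j (Finset.mem_univ j))
  obtain ⟨a, b, X, hab, h0, hc, hX⟩ := exists_boundary_recursion (c := c) (r := r)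
    (fun k => if A k = 0 then 1 else ∑ j, R (k + 1) j)
    (fun k => if A k = 0 then 1 else ∑ j, R k j)
    (fun k => bil (A k) 1 (dropTwo x y u)) (fun k => bil (A k) 1 (dropTwo x y v)) (u x) (v x)
    (by
      intro k hk
      by_cases h : A k = 0
      · simp [h]
      · simpa [h] using sum_ne _ (hR0 k (by omega)) ((hlt k hk).resolve_left h))
    (by
      intro k hk hkc
      by_cases h : A k = 0
      · simp [h]
      · simpa [h] using sum_ne _ (hR0' k (by omega)) ((hgt k hk hkc).resolve_left h))
  refine ⟨a, b, hab, H.bil_merged_le hh _ X h0 (by simpa using hc) fun k hk => ?_⟩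
  by_cases hk0 : A k = 0
  · simp [hk0, bil]
  have hsymm := H.symm k hk
  refine (hA k hk).nonpos_of_pos hsymm (e := 1) ?_ ?_
  · rw [bil_eq_sum]
    simp only [Pi.one_apply, one_mul]
    refine lt_of_le_of_ne (Finset.sum_nonneg fun i _ => Finset.sum_nonneg fun j _ => hA0 k hk i j) ?_
    intro hz
    apply hk0
    ext i j
    have := (Finset.sum_eq_zero_iff_of_nonneg fun i _ =>
      Finset.sum_nonneg fun j _ => hA0 k hk i j).1 hz.symm i (Finset.mem_univ i)
    exact (Finset.sum_eq_zero_iff_of_nonneg fun j _ => hA0 k hk i j).1 this j (Finset.mem_univ j)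
  · have hx : bil (A k) 1 (Pi.single x 1) = ∑ j, R (k + 1) j := by
      rw [bil_comm hsymm, bil_single_left]; simp [H.row_left k hk]
    have hy : bil (A k) 1 (Pi.single y 1) = ∑ j, R k j := by
      rw [bil_comm hsymm, bil_single_left]; simp [H.row_right k hk]
    have := hX k hk
    simp only [hk0, if_false] at this
    rw [dropTwo_combination]
    simp only [bil_add_right, bil_smul_right, hx, hy]
    simpa using this

/-- The case in which all shared rows vanish. -/
lemma noPosPlane_of_shared_eq_zero (H : IsMerge x y c A R h M) (hR : ∀ k ≤ c + 1, R k = 0)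
    (w : σ → ℝ) (hw : ∀ t, w ⬝ᵥ t = 0 → ∀ k ≤ c, bil (A k) t t ≤ 0) : NoPosPlane M := by
  have hh : ∀ k ≤ c + 2, h k = 0 := by
    intro k hk
    rcases Nat.lt_or_ge k (c + 2) with h1 | h1
    · rw [← H.shared_right k (by omega), hR k (by omega)]; rfl
    · rw [show k = c + 1 + 1 by omega, ← H.shared_left (c + 1) le_rfl, hR (c + 1) le_rfl]; rfl
  refine noPosPlane_of_hyperplane (fun t => w ⬝ᵥ dropTwo x y t) ?_ fun t ht => ?_
  · intro a b u v
    simp [dropTwo_combination, dotProduct_add, dotProduct_smul]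
  · rw [H.bil_merged, Finset.sum_eq_zero (s := Finset.range (c + 3)) fun k hk => hh k (by
      have := Finset.mem_range.1 hk; omega),
      Finset.sum_eq_zero (s := Finset.range (c + 2)) fun k hk => by
        rw [hR k (by have := Finset.mem_range.1 hk; omega)]; simp]
    simp only [mul_zero, add_zero]
    exact Finset.sum_nonpos fun k hk =>
      hw _ ht k (Nat.lt_succ_iff.1 (Finset.mem_range.1 hk))

end IsMerge

end Merging

section CoefficientLorentzian

open Finsupp (single)

variable {σ : Type*}

lemma NoPosPlane.bil_eq_zero_of_isotropic [Fintype σ] {B : Matrix σ σ ℝ} (hB : NoPosPlane B)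
    (hs : B.IsSymm) {e f p t : σ → ℝ} (hee : bil B e e = 0) (hff : bil B f f = 0)
    (hef : bil B e f = 0) (hep : bil B e p ≠ 0) (het : bil B e t = 0) : bil B f t = 0 := by
  have key : ∀ s : ℝ, bil B t t + 2 * s * bil B t f ≤ 0 := by
    intro s
    have h1 := hB.nonpos_of_orthogonal hs (t := (1 : ℝ) • t + s • f) hee.ge hep (by
      rw [bil_add_right, bil_smul_right, bil_smul_right, het, hef]; ring)
    rw [bil_combination hs, hff] at h1
    linarith
  rw [bil_comm hs]
  by_contra hne
  have := key ((1 - bil B t t) / (2 * bil B t f))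
  have h2 : 2 * ((1 - bil B t t) / (2 * bil B t f)) * bil B t f = 1 - bil B t t := by
    field_simp
  linarith

/-- M-convexity of a set of exponents in arbitrarily indexed variables. -/
def MConvex (S : Set (σ →₀ ℕ)) : Prop :=
  ∀ α ∈ S, ∀ β ∈ S, ∀ i : σ, β i < α i →
    ∃ j : σ, α j < β j ∧ (α - single i 1 + single j 1) ∈ S ∧ (β - single j 1 + single i 1) ∈ S

/-- The matrix of coefficients of `P` at `γ + e_i + e_j`. It is the Hessian of `∂^γ` of the
normalization of `P`. -/
noncomputable def coeffHess (P : MvPolynomial σ ℝ) (γ : σ →₀ ℕ) : Matrix σ σ ℝ :=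
  Matrix.of fun i j => coeff (γ + single i 1 + single j 1) P

lemma coeffHess_apply (P : MvPolynomial σ ℝ) (γ : σ →₀ ℕ) (i j : σ) :
    coeffHess P γ i j = coeff (γ + single i 1 + single j 1) P := rfl

lemma coeffHess_isSymm (P : MvPolynomial σ ℝ) (γ : σ →₀ ℕ) : (coeffHess P γ).IsSymm := by
  ext i j
  rw [Matrix.transpose_apply, coeffHess_apply, coeffHess_apply, add_right_comm]

/-- The normalization of `P` is Lorentzian, expressed by the coefficients of `P`. -/
structure LorentzianCoeff [Fintype σ] (P : MvPolynomial σ ℝ) : Prop where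
  nonneg : ∀ α, 0 ≤ coeff α P
  mConvex : MConvex {α | coeff α P ≠ 0}
  noPosPlane : ∀ γ, NoPosPlane (coeffHess P γ)

lemma coeff_rename_nonneg {τ : Type*} (f : σ → τ) {P : MvPolynomial σ ℝ}
    (hP : ∀ α, 0 ≤ coeff α P) (β : τ →₀ ℕ) : 0 ≤ coeff β (rename f P) := by
  classical
  rw [P.as_sum, map_sum, coeff_sum]
  refine Finset.sum_nonneg fun α _ => ?_
  rw [rename_monomial, coeff_monomial]
  split_ifs
  exacts [hP α, le_rfl]

lemma coeff_rename_ne_zero_of_nonneg {τ : Type*} (f : σ → τ) {P : MvPolynomial σ ℝ}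
    (hP : ∀ α, 0 ≤ coeff α P) {α : σ →₀ ℕ} (hα : coeff α P ≠ 0) :
    coeff (α.mapDomain f) (rename f P) ≠ 0 := by
  classical
  intro h
  rw [P.as_sum, map_sum, coeff_sum, Finset.sum_eq_zero_iff_of_nonneg] at h
  · have := h α (by simpa using hα)
    rw [rename_monomial, coeff_monomial, if_pos rfl] at this
    exact hα this
  · intro β _
    rw [rename_monomial, coeff_monomial]
    split_ifs
    exacts [hP β, le_rfl]

lemma support_rename_of_nonneg {τ : Type*} (f : σ → τ) {P : MvPolynomial σ ℝ}
    (hP : ∀ α, 0 ≤ coeff α P) :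
    {β | coeff β (rename f P) ≠ 0} = Finsupp.mapDomain f '' {α | coeff α P ≠ 0} := by
  ext β
  constructor
  · intro h
    obtain ⟨u, hu, hu0⟩ := coeff_rename_ne_zero _ _ _ h
    exact ⟨u, hu0, hu⟩
  · rintro ⟨α, hα, rfl⟩
    exact coeff_rename_ne_zero_of_nonneg f hP hα

lemma mapDomain_exchange {τ : Type*} (f : σ → τ) {α : σ →₀ ℕ} {u : σ} (v : σ) (hu : 0 < α u) :
    (α - single u 1 + single v 1).mapDomain f =
      α.mapDomain f - single (f u) 1 + single (f v) 1 := by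
  have h : α = α - single u 1 + single u 1 := by
    rw [tsub_add_cancel_of_le]
    rwa [Finsupp.single_le_iff]
  conv_rhs => rw [h]
  simp only [Finsupp.mapDomain_add, Finsupp.mapDomain_single, add_tsub_cancel_right]

variable [DecidableEq σ]

/-- The map identifying the variable `y` with `x`. -/
def mergeVar (x y : σ) (z : σ) : σ := if z = y then x else z

lemma mapDomain_mergeVar_apply {x y : σ} (hxy : x ≠ y) (α : σ →₀ ℕ) (z : σ) :
    α.mapDomain (mergeVar x y) z = if z = x then α x + α y else if z = y then 0 else α z := by
  induction α using Finsupp.induction_linear with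
  | zero => simp
  | add f g hf hg =>
    rw [Finsupp.mapDomain_add, Finsupp.add_apply, hf, hg]
    split_ifs <;> simp [add_add_add_comm]
  | single a n =>
    rw [Finsupp.mapDomain_single]
    simp only [mergeVar, Finsupp.single_apply]
    grind

lemma coeff_rename_mergeVar_of_ne_zero {x y : σ} (hxy : x ≠ y) (P : MvPolynomial σ ℝ)
    {α : σ →₀ ℕ} (hα : α y ≠ 0) : coeff α (rename (mergeVar x y) P) = 0 := by
  refine coeff_rename_eq_zero _ _ _ fun u hu => ?_
  exact absurd (by rw [← hu, mapDomain_mergeVar_apply hxy]; simp [hxy.symm]) hα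

lemma coeff_rename_mergeVar {x y : σ} (hxy : x ≠ y) (P : MvPolynomial σ ℝ)
    {γ : σ →₀ ℕ} (hx : γ x = 0) (hy : γ y = 0) (n : ℕ) :
    coeff (γ + single x n) (rename (mergeVar x y) P) =
      ∑ k ∈ Finset.range (n + 1), coeff (γ + single x k + single y (n - k)) P := by
  induction P using MvPolynomial.induction_on' with
  | add p q hp hq => simp [hp, hq, Finset.sum_add_distrib]
  | monomial β r =>
    simp only [rename_monomial, coeff_monomial]
    by_cases h : β.mapDomain (mergeVar x y) = γ + single x n
    · rw [if_pos h]
      have hz : ∀ z, _ := fun z => DFunLike.congr_fun h z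
      simp only [mapDomain_mergeVar_apply hxy, Finsupp.add_apply, Finsupp.single_apply] at hz
      have hn : β x + β y = n := by simpa [hx] using hz x
      rw [Finset.sum_eq_single (β x), if_pos]
      · ext z
        simp only [Finsupp.add_apply, Finsupp.single_apply]
        grind
      · intro k _ hk
        rw [if_neg]
        intro hβ
        apply hk
        rw [hβ]
        simp [hx, hxy.symm]
      · intro hk
        simp at hk
        omega
    · rw [if_neg h, Finset.sum_eq_zero]
      intro k hk
      rw [Finset.mem_range] at hk
      rw [if_neg]
      intro hβ
      apply h
      ext z
      rw [mapDomain_mergeVar_apply hxy, hβ]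
      simp only [Finsupp.add_apply, Finsupp.single_apply]
      grind

lemma mapDomain_mergeVar_exchange_of_mem {x y : σ} (hxy : x ≠ y) {u v : σ}
    (hu : u = x ∨ u = y) (hv : v = x ∨ v = y) {α : σ →₀ ℕ} (hα : 0 < α u) :
    (α - single u 1 + single v 1).mapDomain (mergeVar x y) = α.mapDomain (mergeVar x y) := by
  have hf : ∀ w, w = x ∨ w = y → mergeVar x y w = x := by
    rintro w (rfl | rfl) <;> simp [mergeVar]
  rw [mapDomain_exchange _ _ hα, hf u hu, hf v hv, tsub_add_cancel_of_le]
  rw [Finsupp.single_le_iff, mapDomain_mergeVar_apply hxy, if_pos rfl]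
  rcases hu with rfl | rfl <;> omega

/-- Two exchanges through the merged coordinates compose to an exchange in the image. -/
lemma MConvex.exists_mem_mergeVar_eq {S : Set (σ →₀ ℕ)} (hS : MConvex S) {x y : σ} (hxy : x ≠ y)
    {α : σ →₀ ℕ} {i k u v : σ} (hu : u = x ∨ u = y) (hv : v = x ∨ v = y) (huv : u ≠ v)
    (hix : i ≠ x) (hiy : i ≠ y) (hkx : k ≠ x) (hky : k ≠ y) (hik : i ≠ k)
    (hi : 0 < α i) (hαu : 0 < α u) (h1 : α - single i 1 + single v 1 ∈ S)
    (h2 : α - single u 1 + single k 1 ∈ S) :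
    ∃ α' ∈ S, α'.mapDomain (mergeVar x y) =
      α.mapDomain (mergeVar x y) - single i 1 + single k 1 := by
  have hiv : i ≠ v := by rintro rfl; tauto
  have hiu : i ≠ u := by rintro rfl; tauto
  have hku : k ≠ u := by rintro rfl; tauto
  obtain ⟨l, hl, hl', -⟩ := hS _ h2 _ h1 i (by
    simp [hiu.symm, hik.symm, hiv.symm]; omega)
  have hlxy : l = x ∨ l = y := by
    by_contra hne
    push Not at hne
    have hlv : l ≠ v := by rintro rfl; tauto
    have hlu : l ≠ u := by rintro rfl; tauto
    simp [hlv.symm, hlu.symm] at hl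
    omega
  have hi2 : 0 < (α - single u 1 + single k 1 : σ →₀ ℕ) i := by
    simp [hiu.symm, hik.symm]; omega
  have hπu : 0 < α.mapDomain (mergeVar x y) x := by
    rw [mapDomain_mergeVar_apply hxy, if_pos rfl]
    rcases hu with rfl | rfl <;> omega
  have hπi : 0 < α.mapDomain (mergeVar x y) i := by
    rwa [mapDomain_mergeVar_apply hxy, if_neg hix, if_neg hiy]
  have hf : ∀ w, w = x ∨ w = y → mergeVar x y w = x := by
    rintro w (rfl | rfl) <;> simp [mergeVar]
  refine ⟨_, hl', ?_⟩
  rw [mapDomain_exchange _ _ hi2, mapDomain_exchange _ _ hαu, hf u hu, hf l hlxy,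
    show mergeVar x y i = i from if_neg hiy, show mergeVar x y k = k from if_neg hky]
  generalize α.mapDomain (mergeVar x y) = δ at hπu hπi
  ext z
  simp only [Finsupp.add_apply, Finsupp.tsub_apply, Finsupp.single_apply]
  clear * - hπu hπi hix hkx hik
  grind

/-- Identifying two coordinates preserves M-convexity. -/
lemma MConvex.image_mergeVar {S : Set (σ →₀ ℕ)} (hS : MConvex S) {x y : σ} (hxy : x ≠ y) :
    MConvex (Finsupp.mapDomain (mergeVar x y) '' S) := by
  set f := mergeVar x y with hf
  set π : (σ →₀ ℕ) → (σ →₀ ℕ) := Finsupp.mapDomain f with hπ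
  have hπx : ∀ α, π α x = α x + α y := fun α => by
    rw [hπ, mapDomain_mergeVar_apply hxy, if_pos rfl]
  have hπa : ∀ α z, z ≠ x → z ≠ y → π α z = α z := fun α z h1 h2 => by
    rw [hπ, mapDomain_mergeVar_apply hxy, if_neg h1, if_neg h2]
  have hπs : ∀ (α : σ →₀ ℕ) (u v : σ), 0 < α u →
      π (α - single u 1 + single v 1) = π α - single (f u) 1 + single (f v) 1 :=
    fun α u v hu => mapDomain_exchange _ v hu
  have hfxy : ∀ u, u = x ∨ u = y → f u = x := by
    rintro u (rfl | rfl) <;> simp [hf, mergeVar]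
  have hfv : ∀ u, u ≠ x → u ≠ y → f u = u := fun u _ hu => by simp [hf, mergeVar, hu]
  suffices H : ∀ n : ℕ, ∀ α ∈ S, ∀ β ∈ S,
      ((α x : ℤ) - β x).natAbs + ((α y : ℤ) - β y).natAbs = n → ∀ i, π β i < π α i →
      ∃ j, π α j < π β j ∧ (∃ α' ∈ S, π α' = π α - single i 1 + single j 1) ∧
        ∃ β' ∈ S, π β' = π β - single j 1 + single i 1 by
    rintro _ ⟨α, hα, rfl⟩ _ ⟨β, hβ, rfl⟩ i hi
    exact H _ α hα β hβ rfl i hi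
  intro n
  induction n using Nat.strong_induction_on with
  | _ n ih =>
  intro α hα β hβ hn i hi
  -- A representative of `π α` closer to `β` allows to conclude by induction.
  have closer : ∀ u v, (u = x ∧ v = y ∨ u = y ∧ v = x) → β u < α u → α v < β v →
      α - single u 1 + single v 1 ∈ S →
      ∃ j, π α j < π β j ∧ (∃ α' ∈ S, π α' = π α - single i 1 + single j 1) ∧
        ∃ β' ∈ S, π β' = π β - single j 1 + single i 1 := by
    intro u v huv hu hv hmem
    have hπe : π (α - single u 1 + single v 1) = π α :=
      mapDomain_mergeVar_exchange_of_mem hxy (by tauto) (by tauto) (by omega)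
    have := ih _ ?_ _ hmem β hβ rfl i (by rwa [hπe])
    · rwa [hπe] at this
    · simp only [Finsupp.add_apply, Finsupp.tsub_apply, Finsupp.single_apply]
      rcases huv with ⟨rfl, rfl⟩ | ⟨rfl, rfl⟩ <;> simp [hxy, hxy.symm] <;> omega
  by_cases hix : i = x
  · rw [hix] at hi closer ⊢
    rw [hπx, hπx] at hi
    obtain ⟨u, v, huv, hu⟩ : ∃ u v, (u = x ∧ v = y ∨ u = y ∧ v = x) ∧ β u < α u := by
      rcases lt_or_ge (β x) (α x) with h | h
      · exact ⟨x, y, Or.inl ⟨rfl, rfl⟩, h⟩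
      · exact ⟨y, x, Or.inr ⟨rfl, rfl⟩, by omega⟩
    obtain ⟨j, hj, hα', hβ'⟩ := hS α hα β hβ u hu
    by_cases hjv : j = v
    · subst hjv; exact closer u j huv hu hj hα'
    have hju : j ≠ u := by rintro rfl; omega
    have hjx : j ≠ x := by rintro rfl; tauto
    have hjy : j ≠ y := by rintro rfl; tauto
    have hfu : f u = x := hfxy u (by tauto)
    refine ⟨j, by rwa [hπa _ _ hjx hjy, hπa _ _ hjx hjy], ⟨_, hα', ?_⟩, ⟨_, hβ', ?_⟩⟩
    · rw [hπs _ _ _ (by omega), hfu, hfv _ hjx hjy]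
    · rw [hπs _ _ _ (by omega), hfu, hfv _ hjx hjy]
  have hiy : i ≠ y := by
    rintro rfl
    simp [hπ, hf, mapDomain_mergeVar_apply hxy, hix] at hi
  have hi' : β i < α i := by rwa [hπa _ _ hix hiy, hπa _ _ hix hiy] at hi
  obtain ⟨j, hj, hα', hβ'⟩ := hS α hα β hβ i hi'
  by_cases hjxy : j = x ∨ j = y
  · rcases le_or_gt (β x + β y) (α x + α y) with hle | hlt
    · -- Here `α` exceeds `β` in the other merged coordinate.
      obtain ⟨u, huj, hu⟩ : ∃ u, (u = x ∧ j = y ∨ u = y ∧ j = x) ∧ β u < α u := by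
        rcases hjxy with rfl | rfl
        · exact ⟨y, Or.inr ⟨rfl, rfl⟩, by omega⟩
        · exact ⟨x, Or.inl ⟨rfl, rfl⟩, by omega⟩
      obtain ⟨k, hk, hα2, hβ2⟩ := hS α hα β hβ u hu
      by_cases hkj : k = j
      · subst hkj
        exact closer u k huj hu hk hα2
      have hku : k ≠ u := by rintro rfl; omega
      have hkx : k ≠ x := by rintro rfl; tauto
      have hky : k ≠ y := by rintro rfl; tauto
      have hki : k ≠ i := by rintro rfl; omega
      have huj' : u ≠ j := by rintro rfl; omega
      have hux : u = x ∨ u = y := by tauto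
      exact ⟨k, by rwa [hπa _ _ hkx hky, hπa _ _ hkx hky],
        hS.exists_mem_mergeVar_eq hxy hux hjxy huj' hix hiy hkx hky hki.symm (by omega)
          (by omega) hα' hα2,
        hS.exists_mem_mergeVar_eq hxy hjxy hux huj'.symm hkx hky hix hiy hki (by omega)
          (by omega) hβ2 hβ'⟩
    · refine ⟨x, by rwa [hπx, hπx], ⟨_, hα', ?_⟩, ⟨_, hβ', ?_⟩⟩
      · rw [hπs _ _ _ (by omega), hfv i hix hiy, hfxy j hjxy]
      · rw [hπs _ _ _ (by omega), hfv i hix hiy, hfxy j hjxy]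
  · push Not at hjxy
    refine ⟨j, by rwa [hπa _ _ hjxy.1 hjxy.2, hπa _ _ hjxy.1 hjxy.2], ⟨_, hα', ?_⟩, ⟨_, hβ', ?_⟩⟩
    · rw [hπs _ _ _ (by omega), hfv i hix hiy, hfv j hjxy.1 hjxy.2]
    · rw [hπs _ _ _ (by omega), hfv i hix hiy, hfv j hjxy.1 hjxy.2]

end CoefficientLorentzian

section MergingCoefficients

open Finsupp (single)

variable {σ : Type*}

/-- The exponent `γ + k e_x + l e_y`. -/
noncomputable def shiftTwo (γ : σ →₀ ℕ) (x y : σ) (k l : ℕ) : σ →₀ ℕ :=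
  γ + single x k + single y l

lemma shiftTwo_add_left (γ : σ →₀ ℕ) (x y : σ) (k l : ℕ) :
    shiftTwo γ x y k l + single x 1 = shiftTwo γ x y (k + 1) l := by
  rw [shiftTwo, shiftTwo, Finsupp.single_add]
  abel

lemma shiftTwo_add_right (γ : σ →₀ ℕ) (x y : σ) (k l : ℕ) :
    shiftTwo γ x y k l + single y 1 = shiftTwo γ x y k (l + 1) := by
  rw [shiftTwo, shiftTwo, Finsupp.single_add]
  abel

lemma MConvex.shiftTwo_exchange {S : Set (σ →₀ ℕ)} (hS : MConvex S) {γ : σ →₀ ℕ} {x y : σ}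
    (hxy : x ≠ y) {k l k' l' : ℕ} (hk : k' < k) (hl : l < l')
    (h0 : ∀ j, shiftTwo γ x y k (l + 1) + single j 1 ∉ S)
    (h1 : ∀ j, shiftTwo γ x y (k' + 1) l' + single j 1 ∉ S) {p q p' q' : σ}
    (hp : shiftTwo γ x y k l + single p 1 + single q 1 ∈ S)
    (hp' : shiftTwo γ x y k' l' + single p' 1 + single q' 1 ∈ S) :
    p ≠ x ∧ p' ≠ y ∧ shiftTwo γ x y (k - 1) (l + 1) + single p 1 + single q 1 ∈ S ∧
      shiftTwo γ x y (k' + 1) (l' - 1) + single p' 1 + single q' 1 ∈ S := by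
  classical
  have hp'x : p' ≠ x := by
    rintro rfl
    rw [shiftTwo_add_left] at hp'
    exact h1 _ hp'
  have hq'x : q' ≠ x := by
    rintro rfl
    rw [add_right_comm, shiftTwo_add_left] at hp'
    exact h1 _ hp'
  obtain ⟨j, hj, hα, hβ⟩ := hS _ hp _ hp' x (by
    simp only [shiftTwo, Finsupp.add_apply, Finsupp.single_apply]
    grind)
  have hjp' : j ≠ p' := by
    rintro rfl
    apply h1 q'
    convert hβ using 1
    rw [add_right_comm _ (single j 1), add_tsub_cancel_right, add_right_comm, shiftTwo_add_left]
  have hjq' : j ≠ q' := by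
    rintro rfl
    apply h1 p'
    convert hβ using 1
    rw [add_tsub_cancel_right, add_right_comm, shiftTwo_add_left]
  have hjy : j = y := by
    simp only [shiftTwo, Finsupp.add_apply, Finsupp.single_apply] at hj
    grind
  subst hjy
  have hk1 : k = k - 1 + 1 := by omega
  have hl1 : l' = l' - 1 + 1 := by omega
  have hα' : shiftTwo γ x j (k - 1) (l + 1) + single p 1 + single q 1 ∈ S := by
    convert hα using 1
    conv_rhs => rw [hk1, ← shiftTwo_add_left, add_right_comm _ (single x 1),
      add_right_comm _ (single x 1), add_tsub_cancel_right]
    rw [← shiftTwo_add_right]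
    abel
  have hβ' : shiftTwo γ x j (k' + 1) (l' - 1) + single p' 1 + single q' 1 ∈ S := by
    convert hβ using 1
    conv_rhs => rw [hl1, ← shiftTwo_add_right, add_right_comm _ (single j 1),
      add_right_comm _ (single j 1), add_tsub_cancel_right]
    rw [← shiftTwo_add_left]
    abel
  refine ⟨?_, ?_, hα', hβ'⟩
  · rintro rfl
    rw [shiftTwo_add_left, ← hk1] at hα'
    exact h0 _ hα'
  · rintro rfl
    rw [shiftTwo_add_right, ← hl1] at hβ'
    exact h1 _ hβ'

variable [DecidableEq σ]

lemma isMerge_coeffHess (P : MvPolynomial σ ℝ) {x y : σ} (hxy : x ≠ y) {γ : σ →₀ ℕ}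
    (hx : γ x = 0) (hy : γ y = 0) (c : ℕ) :
    IsMerge x y c (fun k => coeffHess P (shiftTwo γ x y k (c - k)))
      (fun k j => coeff (shiftTwo γ x y k (c + 1 - k) + single j 1) P)
      (fun k => coeff (shiftTwo γ x y k (c + 2 - k)) P)
      (coeffHess (rename (mergeVar x y) P) (γ + single x c)) where
  ne := hxy
  symm k _ := coeffHess_isSymm _ _
  row_left k hk j := by
    rw [coeffHess_apply, shiftTwo_add_left, show c + 1 - (k + 1) = c - k by omega]
  row_right k hk j := by
    rw [coeffHess_apply, shiftTwo_add_right, show c - k + 1 = c + 1 - k by omega]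
  shared_left k hk := by
    rw [shiftTwo_add_left, show c + 2 - (k + 1) = c + 1 - k by omega]
  shared_right k hk := by
    rw [shiftTwo_add_right, show c + 1 - k + 1 = c + 2 - k by omega]
  merged_symm := coeffHess_isSymm _ _
  merged i j hix hiy hjx hjy := by
    rw [coeffHess_apply, add_right_comm γ, add_right_comm _ _ (single j 1),
      coeff_rename_mergeVar hxy P (by simp [hx, hix, hjx]) (by simp [hy, hiy, hjy])]
    refine Finset.sum_congr rfl fun k _ => ?_
    rw [coeffHess_apply, shiftTwo]
    congr 1
    abel
  merged_row j hjx hjy := by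
    rw [coeffHess_apply, add_assoc γ, ← Finsupp.single_add, add_right_comm γ,
      coeff_rename_mergeVar hxy P (by simp [hx, hjx]) (by simp [hy, hjy])]
    refine Finset.sum_congr rfl fun k _ => ?_
    rw [shiftTwo]
    congr 1
    abel
  merged_diag := by
    rw [coeffHess_apply, add_assoc γ, ← Finsupp.single_add, add_assoc γ, ← Finsupp.single_add,
      coeff_rename_mergeVar hxy P hx hy]
    rfl
  merged_zero j := coeff_rename_mergeVar_of_ne_zero hxy P (by simp)

variable [Fintype σ]

/-- A linear functional given by a row of the coefficient matrix at one exponent vanishes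
together with the corresponding one at the neighbouring exponent. -/
lemma LorentzianCoeff.row_dotProduct_eq_zero {P : MvPolynomial σ ℝ} (hP : LorentzianCoeff P)
    {δ : σ →₀ ℕ} {a b p q : σ} {t : σ → ℝ}
    (haa : coeff (δ + single a 1 + single a 1 + single p 1) P = 0)
    (hbb : coeff (δ + single b 1 + single b 1 + single p 1) P = 0)
    (hab : coeff (δ + single a 1 + single b 1 + single p 1) P = 0)
    (hq : coeffHess P (δ + single a 1) p q ≠ 0) (ht : coeffHess P (δ + single a 1) p ⬝ᵥ t = 0) :
    coeffHess P (δ + single b 1) p ⬝ᵥ t = 0 := by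
  have hrow : ∀ z v, bil (coeffHess P (δ + single p 1)) (Pi.single z 1) v =
      coeffHess P (δ + single z 1) p ⬝ᵥ v := by
    intro z v
    rw [bil_single_left]
    refine Finset.sum_congr rfl fun j _ => ?_
    rw [coeffHess_apply, coeffHess_apply, add_right_comm δ]
  have hent : ∀ z w, bil (coeffHess P (δ + single p 1)) (Pi.single z 1) (Pi.single w 1) =
      coeff (δ + single z 1 + single w 1 + single p 1) P := by
    intro z w
    rw [hrow, dotProduct_single, mul_one, coeffHess_apply, add_right_comm]
  rw [← hrow] at ht ⊢
  refine (hP.noPosPlane (δ + single p 1)).bil_eq_zero_of_isotropic (coeffHess_isSymm _ _)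
    (p := Pi.single q 1) ((hent a a).trans haa) ((hent b b).trans hbb) ((hent a b).trans hab) ?_ ht
  rw [hrow, dotProduct_single, mul_one]
  exact hq

/-- If all entries shared by consecutive matrices vanish, then the matrices are nonpositive on
a common hyperplane. -/
lemma LorentzianCoeff.exists_common_hyperplane {P : MvPolynomial σ ℝ} (hP : LorentzianCoeff P)
    {x y : σ} (hxy : x ≠ y) (γ : σ →₀ ℕ) (c : ℕ)
    (hR : ∀ k ≤ c + 1, ∀ j, coeff (shiftTwo γ x y k (c + 1 - k) + single j 1) P = 0) {k₀ : ℕ}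
    (hk₀ : k₀ ≤ c) {p q : σ} (hpq : coeffHess P (shiftTwo γ x y k₀ (c - k₀)) p q ≠ 0)
    (t : σ → ℝ) (ht : coeffHess P (shiftTwo γ x y k₀ (c - k₀)) p ⬝ᵥ t = 0) (k : ℕ) (hk : k ≤ c) :
    bil (coeffHess P (shiftTwo γ x y k (c - k))) t t ≤ 0 := by
  by_cases hA : coeffHess P (shiftTwo γ x y k (c - k)) = 0
  · simp [hA, bil]
  obtain ⟨p', q', hpq'⟩ : ∃ p' q', coeffHess P (shiftTwo γ x y k (c - k)) p' q' ≠ 0 := by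
    by_contra! h
    exact hA (Matrix.ext h)
  have hpair : ∀ i i', i' < i → i ≤ c → ∀ u v u' v',
      coeffHess P (shiftTwo γ x y i (c - i)) u v ≠ 0 →
      coeffHess P (shiftTwo γ x y i' (c - i')) u' v' ≠ 0 →
      coeffHess P (shiftTwo γ x y (i - 1) (c - (i - 1))) u v ≠ 0 ∧
      coeffHess P (shiftTwo γ x y (i' + 1) (c - (i' + 1))) u' v' ≠ 0 := by
    intro i i' hi hic u v u' v' h1 h2
    have := hP.mConvex.shiftTwo_exchange hxy hi (l := c - i) (l' := c - i') (by omega)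
      (fun j => by
        have := hR i (by omega) j
        rw [show c + 1 - i = c - i + 1 by omega] at this
        simpa using this)
      (fun j => by
        have := hR (i' + 1) (by omega) j
        rw [show c + 1 - (i' + 1) = c - i' by omega] at this
        simpa using this) h1 h2
    rw [show c - i + 1 = c - (i - 1) by omega, show c - i' - 1 = c - (i' + 1) by omega] at this
    exact this.2.2
  have key : coeffHess P (shiftTwo γ x y k (c - k)) p q ≠ 0 ∧
      coeffHess P (shiftTwo γ x y k (c - k)) p ⬝ᵥ t = 0 := by
    have hRa : ∀ i l, i + l = c + 1 → coeff (shiftTwo γ x y i l + single p 1) P = 0 := by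
      intro i l hil
      have := hR i (by omega) p
      rwa [show c + 1 - i = l by omega] at this
    rcases le_or_gt k₀ k with hle | hlt
    · suffices H : ∀ i, k₀ ≤ i → i ≤ k → coeffHess P (shiftTwo γ x y i (c - i)) p q ≠ 0 ∧
          coeffHess P (shiftTwo γ x y i (c - i)) p ⬝ᵥ t = 0 from H k hle le_rfl
      intro i hi
      induction i, hi using Nat.le_induction with
      | base => exact fun _ => ⟨hpq, ht⟩
      | succ i hi ih =>
        intro hik
        obtain ⟨h1, h2⟩ := ih (by omega)
        refine ⟨(hpair k i (by omega) hk _ _ _ _ hpq' h1).2, ?_⟩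
        rw [show c - i = c - (i + 1) + 1 by omega, ← shiftTwo_add_right] at h1 h2
        rw [← shiftTwo_add_left]
        refine hP.row_dotProduct_eq_zero ?_ ?_ ?_ h1 h2 <;>
        simp only [shiftTwo_add_left, shiftTwo_add_right] <;> exact hRa _ _ (by omega)
    · suffices H : ∀ n, n ≤ k₀ - k →
          coeffHess P (shiftTwo γ x y (k₀ - n) (c - (k₀ - n))) p q ≠ 0 ∧
          coeffHess P (shiftTwo γ x y (k₀ - n) (c - (k₀ - n))) p ⬝ᵥ t = 0 by
        have := H (k₀ - k) le_rfl
        rwa [show k₀ - (k₀ - k) = k by omega] at this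
      intro n
      induction n with
      | zero => exact fun _ => ⟨hpq, ht⟩
      | succ n ih =>
        intro hn
        obtain ⟨h1, h2⟩ := ih (by omega)
        obtain ⟨i, hi⟩ : ∃ i, k₀ - n = i + 1 := ⟨k₀ - n - 1, by omega⟩
        rw [hi] at h1 h2
        rw [show k₀ - (n + 1) = i by omega]
        refine ⟨(hpair (i + 1) k (by omega) (by omega) _ _ _ _ h1 hpq').1, ?_⟩
        rw [← shiftTwo_add_left] at h1 h2
        rw [show c - i = c - (i + 1) + 1 by omega, ← shiftTwo_add_right]
        refine hP.row_dotProduct_eq_zero ?_ ?_ ?_ h1 h2 <;>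
        simp only [shiftTwo_add_left, shiftTwo_add_right] <;> exact hRa _ _ (by omega)
  have hrow : ∀ v, bil (coeffHess P (shiftTwo γ x y k (c - k))) (Pi.single p 1) v =
      coeffHess P (shiftTwo γ x y k (c - k)) p ⬝ᵥ v := fun v => bil_single_left _ _ _
  refine (hP.noPosPlane _).nonpos_of_orthogonal (coeffHess_isSymm _ _) (e := Pi.single p 1)
    (p := Pi.single q 1) ?_ ?_ ?_
  · rw [hrow, dotProduct_single, mul_one]
    exact hP.nonneg _
  · rw [hrow, dotProduct_single, mul_one]
    exact key.1
  · rw [hrow]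
    exact key.2

lemma LorentzianCoeff.noPosPlane_mergeVar {P : MvPolynomial σ ℝ} (hP : LorentzianCoeff P)
    {x y : σ} (hxy : x ≠ y) (γ : σ →₀ ℕ) (hx : γ x = 0) (hy : γ y = 0) (c : ℕ) :
    NoPosPlane (coeffHess (rename (mergeVar x y) P) (γ + single x c)) := by
  have H := isMerge_coeffHess P hxy hx hy c
  set A := fun k => coeffHess P (shiftTwo γ x y k (c - k)) with hA
  set R : ℕ → σ → ℝ := fun k j => coeff (shiftTwo γ x y k (c + 1 - k) + single j 1) P with hR
  have hAP : ∀ k ≤ c, NoPosPlane (A k) := fun k _ => hP.noPosPlane _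
  have hA0 : ∀ k ≤ c, ∀ i j, 0 ≤ A k i j := fun k _ i j => hP.nonneg _
  have hne : ∀ k, A k ≠ 0 → ∃ p q, A k p q ≠ 0 := by
    intro k hk
    by_contra! h
    exact hk (Matrix.ext h)
  obtain ⟨r, hr, hlt, hr'⟩ : ∃ r ≤ c, (∀ k < r, A k = 0 ∨ R (k + 1) ≠ 0) ∧
      (r = c ∨ (A r ≠ 0 ∧ R (r + 1) = 0)) := by
    classical
    by_cases hex : ∃ k, k ≤ c ∧ A k ≠ 0 ∧ R (k + 1) = 0
    · have h1 := Nat.find_spec hex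
      refine ⟨Nat.find hex, h1.1, fun k hk => ?_, Or.inr h1.2⟩
      have h2 := Nat.find_min hex hk
      have h3 : k ≤ c := hk.le.trans h1.1
      tauto
    · push Not at hex
      refine ⟨c, le_rfl, fun k hk => ?_, Or.inl rfl⟩
      have := hex k hk.le
      tauto
  by_cases hgt : ∀ k, r < k → k ≤ c → A k = 0 ∨ R k ≠ 0
  · exact H.noPosPlane hAP hA0 (fun k => hP.nonneg _) hr hlt hgt
  push Not at hgt
  obtain ⟨k, hrk, hkc, hAk, hRk⟩ := hgt
  obtain ⟨hAr, hRr⟩ := hr'.resolve_left (by omega)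
  have hpair : ∀ i i', i' < i → i ≤ c → R i = 0 → R (i' + 1) = 0 → ∀ u v u' v',
      A i u v ≠ 0 → A i' u' v' ≠ 0 → u ≠ x ∧ u' ≠ y := by
    intro i i' hi hic h0 h1 u v u' v' hu hu'
    have := hP.mConvex.shiftTwo_exchange hxy hi (l := c - i) (l' := c - i') (by omega)
      (fun j => by
        have := congrFun h0 j
        simp only [hR, show c + 1 - i = c - i + 1 by omega] at this
        simpa using this)
      (fun j => by
        have := congrFun h1 j
        simp only [hR, show c + 1 - (i' + 1) = c - i' by omega] at this
        simpa using this) hu hu'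
    exact ⟨this.1, this.2.1⟩
  have hdown : ∀ n ≤ k, R (k - n) = 0 := by
    intro n
    induction n with
    | zero => exact fun _ => hRk
    | succ n ih =>
      intro hn
      have h1 := ih (by omega)
      obtain ⟨i, hi⟩ : ∃ i, k - n = i + 1 := ⟨k - n - 1, by omega⟩
      rw [hi] at h1
      rw [show k - (n + 1) = i by omega]
      obtain ⟨p, q, hpq⟩ := hne k hAk
      funext j
      by_contra hj
      rw [← H.row_right i (by omega) j] at hj
      exact (hpair k i (by omega) hkc hRk h1 _ _ _ _ hpq hj).2 rfl
  have hup : ∀ i, r + 1 ≤ i → i ≤ c + 1 → R i = 0 := by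
    intro i hi
    induction i, hi using Nat.le_induction with
    | base => exact fun _ => hRr
    | succ i hi ih =>
      intro hic
      obtain ⟨p, q, hpq⟩ := hne r hAr
      funext j
      by_contra hj
      rw [← H.row_left i (by omega) j] at hj
      exact (hpair i r (by omega) (by omega) (ih (by omega)) hRr _ _ _ _ hj hpq).1 rfl
  have hRall : ∀ i ≤ c + 1, R i = 0 := by
    intro i hi
    rcases le_or_gt i k with h | h
    · have := hdown (k - i) (by omega)
      rwa [show k - (k - i) = i by omega] at this
    · exact hup i (by omega) hi
  obtain ⟨p, q, hpq⟩ := hne k hAk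
  exact H.noPosPlane_of_shared_eq_zero hRall (A k p) fun t ht i hi =>
    hP.exists_common_hyperplane hxy γ c (fun i hi j => congrFun (hRall i hi) j) hkc hpq t ht i hi

/-- Identifying two variables preserves the Lorentzian property of the normalization. -/
lemma LorentzianCoeff.rename_mergeVar {P : MvPolynomial σ ℝ} (hP : LorentzianCoeff P) {x y : σ}
    (hxy : x ≠ y) : LorentzianCoeff (rename (mergeVar x y) P) where
  nonneg := coeff_rename_nonneg _ hP.nonneg
  mConvex := by
    rw [support_rename_of_nonneg _ hP.nonneg]
    exact hP.mConvex.image_mergeVar hxy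
  noPosPlane γ := by
    by_cases hy : γ y = 0
    · have := hP.noPosPlane_mergeVar hxy (γ.erase x) (by simp)
        (by simp [Finsupp.erase_ne hxy.symm, hy]) (γ x)
      rwa [Finsupp.erase_add_single] at this
    · refine noPosPlane_of_nonpos fun t => ?_
      rw [bil_eq_sum]
      refine (Finset.sum_eq_zero fun i _ => Finset.sum_eq_zero fun j _ => ?_).le
      rw [coeffHess_apply, coeff_rename_mergeVar_of_ne_zero hxy P (by simp [hy]), mul_zero]

end MergingCoefficients

section DisjointProduct

open Finsupp (single)

variable {σ τ : Type*}

/-- The part of an exponent in the left variables. -/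
noncomputable def leftExponent (γ : σ ⊕ τ →₀ ℕ) : σ →₀ ℕ :=
  γ.comapDomain Sum.inl Sum.inl_injective.injOn

/-- The part of an exponent in the right variables. -/
noncomputable def rightExponent (γ : σ ⊕ τ →₀ ℕ) : τ →₀ ℕ :=
  γ.comapDomain Sum.inr Sum.inr_injective.injOn

@[simp] lemma leftExponent_apply (γ : σ ⊕ τ →₀ ℕ) (i : σ) : leftExponent γ i = γ (Sum.inl i) := rfl

@[simp] lemma rightExponent_apply (γ : σ ⊕ τ →₀ ℕ) (i : τ) :
    rightExponent γ i = γ (Sum.inr i) := rfl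

@[simp] lemma leftExponent_add (γ δ : σ ⊕ τ →₀ ℕ) :
    leftExponent (γ + δ) = leftExponent γ + leftExponent δ := by ext; simp

@[simp] lemma rightExponent_add (γ δ : σ ⊕ τ →₀ ℕ) :
    rightExponent (γ + δ) = rightExponent γ + rightExponent δ := by ext; simp

@[simp] lemma leftExponent_sub (γ δ : σ ⊕ τ →₀ ℕ) :
    leftExponent (γ - δ) = leftExponent γ - leftExponent δ := by ext; simp

@[simp] lemma rightExponent_sub (γ δ : σ ⊕ τ →₀ ℕ) :
    rightExponent (γ - δ) = rightExponent γ - rightExponent δ := by ext; simp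

@[simp] lemma leftExponent_single_inl (i : σ) (n : ℕ) :
    leftExponent (single (Sum.inl i) n : σ ⊕ τ →₀ ℕ) = single i n := by
  classical ext; simp [Finsupp.single_apply]

@[simp] lemma leftExponent_single_inr (i : τ) (n : ℕ) :
    leftExponent (single (Sum.inr i) n : σ ⊕ τ →₀ ℕ) = 0 := by
  ext; simp

@[simp] lemma rightExponent_single_inl (i : σ) (n : ℕ) :
    rightExponent (single (Sum.inl i) n : σ ⊕ τ →₀ ℕ) = 0 := by
  ext; simp

@[simp] lemma rightExponent_single_inr (i : τ) (n : ℕ) :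
    rightExponent (single (Sum.inr i) n : σ ⊕ τ →₀ ℕ) = single i n := by
  classical ext; simp [Finsupp.single_apply]

lemma mapDomain_inl_add_mapDomain_inr_eq_iff (α : σ →₀ ℕ) (β : τ →₀ ℕ) (γ : σ ⊕ τ →₀ ℕ) :
    α.mapDomain Sum.inl + β.mapDomain Sum.inr = γ ↔
      α = leftExponent γ ∧ β = rightExponent γ := by
  have hl : ∀ i, (α.mapDomain Sum.inl + β.mapDomain Sum.inr : σ ⊕ τ →₀ ℕ) (Sum.inl i) = α i := by
    intro i
    rw [Finsupp.add_apply, Finsupp.mapDomain_apply Sum.inl_injective,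
      Finsupp.mapDomain_of_notMem_range, add_zero]
    simp
  have hr : ∀ i, (α.mapDomain Sum.inl + β.mapDomain Sum.inr : σ ⊕ τ →₀ ℕ) (Sum.inr i) = β i := by
    intro i
    rw [Finsupp.add_apply, Finsupp.mapDomain_apply Sum.inr_injective,
      Finsupp.mapDomain_of_notMem_range, zero_add]
    simp
  constructor
  · rintro rfl
    exact ⟨Finsupp.ext fun i => (hl i).symm, Finsupp.ext fun i => (hr i).symm⟩
  · rintro ⟨h1, h2⟩
    ext (i | i)
    · rw [hl, h1, leftExponent_apply]
    · rw [hr, h2, rightExponent_apply]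

lemma coeff_rename_inl_mul_rename_inr (P : MvPolynomial σ ℝ) (Q : MvPolynomial τ ℝ)
    (γ : σ ⊕ τ →₀ ℕ) : coeff γ (rename Sum.inl P * rename Sum.inr Q) =
      coeff (leftExponent γ) P * coeff (rightExponent γ) Q := by
  classical
  induction P using MvPolynomial.induction_on' with
  | add p q hp hq => simp [add_mul, hp, hq]
  | monomial α a =>
    induction Q using MvPolynomial.induction_on' with
    | add p q hp hq => simp only [map_add, mul_add, coeff_add, hp, hq]
    | monomial β b =>
      simp only [rename_monomial, monomial_mul, coeff_monomial,
        mapDomain_inl_add_mapDomain_inr_eq_iff]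
      by_cases h1 : α = leftExponent γ <;> by_cases h2 : β = rightExponent γ <;> simp [h1, h2]

lemma MConvex.sum {S : Set (σ →₀ ℕ)} {T : Set (τ →₀ ℕ)} (hS : MConvex S) (hT : MConvex T) :
    MConvex {γ : σ ⊕ τ →₀ ℕ | leftExponent γ ∈ S ∧ rightExponent γ ∈ T} := by
  rintro α ⟨hα1, hα2⟩ β ⟨hβ1, hβ2⟩ (i | i) hi
  · obtain ⟨j, hj, h1, h2⟩ := hS _ hα1 _ hβ1 i hi
    exact ⟨Sum.inl j, hj, by simpa using ⟨h1, hα2⟩, by simpa using ⟨h2, hβ2⟩⟩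
  · obtain ⟨j, hj, h1, h2⟩ := hT _ hα2 _ hβ2 i hi
    exact ⟨Sum.inr j, hj, by simpa using ⟨hα1, h1⟩, by simpa using ⟨hβ1, h2⟩⟩

lemma coeff_add_eq_zero_of_ne_zero {P : MvPolynomial σ ℝ} {d : ℕ} (hP : P.IsHomogeneous d)
    {γ δ : σ →₀ ℕ} (hδ : δ ≠ 0) (h : coeff γ P ≠ 0) : coeff (γ + δ) P = 0 := by
  by_contra h2
  have h3 : γ.degree = d := not_imp_comm.1 hP.coeff_eq_zero h
  have h4 : (γ + δ).degree = d := not_imp_comm.1 hP.coeff_eq_zero h2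
  rw [map_add, h3] at h4
  exact hδ ((Finsupp.degree_eq_zero_iff δ).1 (by omega))

variable [Fintype σ] [Fintype τ]

lemma NoPosPlane.smul_comp {κ : Type*} [Fintype κ] {A : Matrix σ σ ℝ} (hA : NoPosPlane A)
    {M : Matrix κ κ ℝ} {f : σ → κ} {r : ℝ} (hr : 0 ≤ r)
    (h : ∀ t, bil M t t = r * bil A (t ∘ f) (t ∘ f)) : NoPosPlane M := by
  intro u v
  obtain ⟨a, b, hab, hle⟩ := hA (u ∘ f) (v ∘ f)
  refine ⟨a, b, hab, ?_⟩
  rw [h]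
  exact mul_nonpos_of_nonneg_of_nonpos hr hle

/-- The product of polynomials in disjoint variables has Lorentzian normalization if both
factors do. -/
lemma LorentzianCoeff.mul_disjoint {P : MvPolynomial σ ℝ} {Q : MvPolynomial τ ℝ} {d e : ℕ}
    (hPd : P.IsHomogeneous d) (hQe : Q.IsHomogeneous e) (hP : LorentzianCoeff P)
    (hQ : LorentzianCoeff Q) : LorentzianCoeff (rename Sum.inl P * rename Sum.inr Q) where
  nonneg γ := by
    rw [coeff_rename_inl_mul_rename_inr]
    exact mul_nonneg (hP.nonneg _) (hQ.nonneg _)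
  mConvex := by
    simpa only [coeff_rename_inl_mul_rename_inr, mul_ne_zero_iff, Set.mem_ofPred_eq] using
      hP.mConvex.sum hQ.mConvex
  noPosPlane γ := by
    have hM : ∀ t, bil (coeffHess (rename Sum.inl P * rename Sum.inr Q) γ) t t =
        coeff (rightExponent γ) Q *
          bil (coeffHess P (leftExponent γ)) (t ∘ Sum.inl) (t ∘ Sum.inl) +
        2 * ((∑ i, coeff (leftExponent γ + single i 1) P * t (Sum.inl i)) *
          ∑ j, coeff (rightExponent γ + single j 1) Q * t (Sum.inr j)) +
        coeff (leftExponent γ) P *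
          bil (coeffHess Q (rightExponent γ)) (t ∘ Sum.inr) (t ∘ Sum.inr) := by
      intro t
      simp only [bil_eq_sum, Fintype.sum_sum_type, coeffHess_apply,
        coeff_rename_inl_mul_rename_inr, leftExponent_add, rightExponent_add,
        leftExponent_single_inl, leftExponent_single_inr, rightExponent_single_inl,
        rightExponent_single_inr, add_zero, Function.comp_apply, Finset.sum_add_distrib]
      have h1 : ∀ (f : σ → ℝ) (g : τ → ℝ), 2 * ((∑ i, f i) * ∑ j, g j) =
          ∑ j, ∑ i, f i * g j + ∑ i, ∑ j, f i * g j := by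
        intro f g
        rw [Finset.sum_comm, Finset.sum_mul_sum]
        ring
      rw [h1]
      simp only [Finset.mul_sum]
      have h2 : ∀ a b c d a' b' c' d' : ℝ, a = a' → b = b' → c = c' → d = d' →
          a + b + (c + d) = a' + (b' + c') + d' := by
        rintro a b c d _ _ _ _ rfl rfl rfl rfl
        ring
      apply h2 <;> refine Finset.sum_congr rfl fun i _ => Finset.sum_congr rfl fun j _ => ?_ <;>
        ring
    by_cases hq : coeff (rightExponent γ) Q = 0
    · by_cases hp : coeff (leftExponent γ) P = 0
      · refine noPosPlane_of_hyperplane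
          (fun t => ∑ i, coeff (leftExponent γ + single i 1) P * t (Sum.inl i)) ?_ ?_
        · intro a b u v
          simp only [Finset.mul_sum, ← Finset.sum_add_distrib]
          refine Finset.sum_congr rfl fun i _ => ?_
          simp only [Pi.add_apply, Pi.smul_apply, smul_eq_mul]
          ring
        · intro t ht
          rw [hM, hq, hp, ht]
          simp
      · refine (hQ.noPosPlane (rightExponent γ)).smul_comp (f := Sum.inr)
          (hP.nonneg (leftExponent γ)) fun t => ?_
        rw [hM, hq]
        simp [coeff_add_eq_zero_of_ne_zero hPd _ hp]
    · refine (hP.noPosPlane (leftExponent γ)).smul_comp (f := Sum.inl)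
        (hQ.nonneg (rightExponent γ)) fun t => ?_
      have hB : coeffHess Q (rightExponent γ) = 0 := by
        ext i j
        rw [coeffHess_apply, add_assoc, coeff_add_eq_zero_of_ne_zero hQe (by simp) hq]
        rfl
      rw [hM, hB]
      simp [coeff_add_eq_zero_of_ne_zero hQe _ hq, bil]

end DisjointProduct

section Diagonal

open Finsupp (single)

variable {σ : Type*}

lemma LorentzianCoeff.of_rename_injective [Fintype σ] {τ : Type*} [Fintype τ] {f : σ → τ}
    (hf : Function.Injective f) {P : MvPolynomial σ ℝ} (h : LorentzianCoeff (rename f P)) :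
    LorentzianCoeff P where
  nonneg α := by
    rw [← coeff_rename_mapDomain f hf]
    exact h.nonneg _
  mConvex := by
    intro α hα β hβ i hi
    have hmem : ∀ δ, coeff δ P ≠ 0 ↔ coeff (δ.mapDomain f) (rename f P) ≠ 0 := fun δ => by
      rw [coeff_rename_mapDomain f hf]
    obtain ⟨j, hj, h1, h2⟩ := h.mConvex _ ((hmem α).1 hα) _ ((hmem β).1 hβ) (f i) (by
      rwa [Finsupp.mapDomain_apply hf, Finsupp.mapDomain_apply hf])
    obtain ⟨k, rfl⟩ : j ∈ Set.range f := by
      by_contra hj'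
      rw [Finsupp.mapDomain_of_notMem_range _ _ hj', Finsupp.mapDomain_of_notMem_range _ _ hj'] at hj
      exact hj.false
    rw [Finsupp.mapDomain_apply hf, Finsupp.mapDomain_apply hf] at hj
    refine ⟨k, hj, (hmem _).2 ?_, (hmem _).2 ?_⟩
    · rwa [mapDomain_exchange f k (by omega)]
    · rwa [mapDomain_exchange f i (by omega)]
  noPosPlane γ := by
    classical
    have hent : ∀ i j, coeffHess (rename f P) (γ.mapDomain f) (f i) (f j) = coeffHess P γ i j := by
      intro i j
      rw [coeffHess_apply, coeffHess_apply, ← coeff_rename_mapDomain f hf]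
      simp only [Finsupp.mapDomain_add, Finsupp.mapDomain_single]
    intro u v
    obtain ⟨a, b, hab, hle⟩ := h.noPosPlane (γ.mapDomain f) (Function.extend f u 0)
      (Function.extend f v 0)
    refine ⟨a, b, hab, hle.trans' (le_of_eq ?_)⟩
    have hext : a • Function.extend f u 0 + b • Function.extend f v 0 =
        Function.extend f (a • u + b • v) (0 : τ → ℝ) := by
      funext z
      by_cases hz : ∃ i, f i = z
      · obtain ⟨i, rfl⟩ := hz
        simp [hf.extend_apply]
      · simp [Function.extend_apply' _ _ _ hz]
    have hsum : ∀ g : τ → ℝ, (∀ z, (¬ ∃ i, f i = z) → g z = 0) → ∑ z, g z = ∑ i, g (f i) := by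
      intro g hg
      rw [← Finset.sum_image (s := Finset.univ) (g := f) (f := g) hf.injOn]
      symm
      refine Finset.sum_subset (Finset.subset_univ _) fun z _ hz => hg z ?_
      simpa using hz
    rw [hext, bil_eq_sum, bil_eq_sum, hsum]
    · refine Finset.sum_congr rfl fun i _ => ?_
      rw [hsum]
      · simp only [hf.extend_apply, hent]
      · intro z hz
        rw [Function.extend_apply' _ _ _ hz]
        simp
    · intro z hz
      refine Finset.sum_eq_zero fun w _ => ?_
      rw [Function.extend_apply' _ _ _ hz]
      simp

/-- Identify `inr i` with `inl i` for all `i` in a list. -/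
def mergeList [DecidableEq σ] (l : List σ) : σ ⊕ σ → σ ⊕ σ
  | Sum.inl i => Sum.inl i
  | Sum.inr i => if i ∈ l then Sum.inl i else Sum.inr i

lemma mergeVar_comp_mergeList [DecidableEq σ] (i : σ) (l : List σ) :
    mergeVar (Sum.inl i) (Sum.inr i) ∘ mergeList l = mergeList (i :: l) := by
  funext z
  rcases z with j | j
  · simp [mergeVar, mergeList]
  · by_cases hj : j ∈ l <;> by_cases hij : j = i <;> simp [mergeVar, mergeList, hj, hij]

lemma LorentzianCoeff.rename_mergeList [Fintype σ] [DecidableEq σ] {P : MvPolynomial (σ ⊕ σ) ℝ}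
    (hP : LorentzianCoeff P) (l : List σ) : LorentzianCoeff (rename (mergeList l) P) := by
  induction l with
  | nil =>
    have : mergeList ([] : List σ) = id := by funext z; rcases z with j | j <;> simp [mergeList]
    rwa [this, rename_id_apply]
  | cons i l ih =>
    rw [← mergeVar_comp_mergeList, ← rename_rename]
    exact ih.rename_mergeVar (by simp)

lemma LorentzianCoeff.mul [Fintype σ] {P Q : MvPolynomial σ ℝ} {d e : ℕ}
    (hPd : P.IsHomogeneous d) (hQe : Q.IsHomogeneous e) (hP : LorentzianCoeff P)
    (hQ : LorentzianCoeff Q) : LorentzianCoeff (P * Q) := by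
  classical
  have h := (hP.mul_disjoint hPd hQe hQ).rename_mergeList Finset.univ.toList
  rw [map_mul, rename_rename, rename_rename] at h
  have h1 : mergeList (Finset.univ : Finset σ).toList ∘ Sum.inl = Sum.inl := rfl
  have h2 : mergeList (Finset.univ : Finset σ).toList ∘ Sum.inr = Sum.inl := by
    funext i
    simp [mergeList]
  rw [h1, h2, ← map_mul] at h
  exact h.of_rename_injective Sum.inl_injective

end Diagonal

section Normalization

open Finsupp (single)

variable {m : ℕ}

lemma coeff_normalizePoly (P : MvPolynomial (Fin m) ℝ) (α : Fin m →₀ ℕ) :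
    coeff α (normalizePoly P) = coeff α P / ∏ i, ((α i).factorial : ℝ) := by
  rw [normalizePoly, coeff_sum]
  simp only [coeff_monomial]
  rw [Finset.sum_ite_eq']
  split_ifs with h
  · rfl
  · rw [notMem_support_iff.1 h, zero_div]

/-- The coefficient with respect to the divided monomials `w^α / α!`. -/
noncomputable def dividedCoeff (α : Fin m →₀ ℕ) (F : MvPolynomial (Fin m) ℝ) : ℝ :=
  coeff α F * ∏ i, ((α i).factorial : ℝ)

lemma prod_factorial_pos (α : Fin m →₀ ℕ) : 0 < ∏ i, ((α i).factorial : ℝ) :=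
  Finset.prod_pos fun i _ => by exact_mod_cast (α i).factorial_pos

lemma dividedCoeff_normalizePoly (α : Fin m →₀ ℕ) (P : MvPolynomial (Fin m) ℝ) :
    dividedCoeff α (normalizePoly P) = coeff α P := by
  rw [dividedCoeff, coeff_normalizePoly, div_mul_cancel₀ _ (prod_factorial_pos α).ne']

lemma dividedCoeff_pderiv (α : Fin m →₀ ℕ) (i : Fin m) (F : MvPolynomial (Fin m) ℝ) :
    dividedCoeff α (pderiv i F) = dividedCoeff (α + single i 1) F := by
  have h : ∏ j, (((α + single i 1 : Fin m →₀ ℕ) j).factorial : ℝ) =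
      (α i + 1) * ∏ j, ((α j).factorial : ℝ) := by
    rw [← Finset.mul_prod_erase Finset.univ _ (Finset.mem_univ i),
      ← Finset.mul_prod_erase Finset.univ (fun j => ((α j).factorial : ℝ)) (Finset.mem_univ i),
      ← mul_assoc]
    congr 1
    · simp [Nat.factorial_succ]
    · refine Finset.prod_congr rfl fun j hj => ?_
      simp [(Finset.ne_of_mem_erase hj).symm]
  rw [dividedCoeff, dividedCoeff, coeff_pderiv, h]
  ring

lemma dividedCoeff_pderiv_iterate (α : Fin m →₀ ℕ) (i : Fin m) (n : ℕ)
    (F : MvPolynomial (Fin m) ℝ) :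
    dividedCoeff α ((fun R => pderiv i R)^[n] F) = dividedCoeff (α + single i n) F := by
  induction n generalizing α with
  | zero => simp
  | succ n ih =>
    rw [Function.iterate_succ_apply', dividedCoeff_pderiv, ih, add_assoc, ← Finsupp.single_add,
      add_comm 1]

lemma dividedCoeff_pderivMulti (α : Fin m →₀ ℕ) (γ : Fin m →₀ ℕ) (F : MvPolynomial (Fin m) ℝ) :
    dividedCoeff α (pderivMulti γ F) = dividedCoeff (α + γ) F := by
  have h : ∀ (l : List (Fin m)) (α : Fin m →₀ ℕ),
      dividedCoeff α (l.foldr (fun i Q => (fun R => pderiv i R)^[γ i] Q) F) =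
        dividedCoeff (α + (l.map fun i => single i (γ i)).sum) F := by
    intro l
    induction l with
    | nil => simp
    | cons i l ih =>
      intro α
      rw [List.foldr_cons, dividedCoeff_pderiv_iterate, ih, List.map_cons, List.sum_cons, add_assoc]
  rw [pderivMulti, h, ← Fin.sum_univ_def, Finsupp.univ_sum_single]

lemma hess_pderivMulti_normalizePoly (γ : Fin m →₀ ℕ) (P : MvPolynomial (Fin m) ℝ) :
    hess (pderivMulti γ (normalizePoly P)) = coeffHess P γ := by
  ext i j
  have h : ∀ F : MvPolynomial (Fin m) ℝ, coeff 0 F = dividedCoeff 0 F := by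
    simp [dividedCoeff]
  rw [hess, Matrix.of_apply, h, dividedCoeff_pderiv, dividedCoeff_pderiv,
    dividedCoeff_pderivMulti, dividedCoeff_normalizePoly, coeffHess_apply]
  congr 1
  abel

lemma isHomogeneous_normalizePoly {P : MvPolynomial (Fin m) ℝ} {d : ℕ} (hP : P.IsHomogeneous d) :
    (normalizePoly P).IsHomogeneous d := by
  intro α hα
  refine hP fun h => hα ?_
  rw [coeff_normalizePoly, h, zero_div]

lemma lorentzian_normalizePoly_iff {P : MvPolynomial (Fin m) ℝ} {d : ℕ}
    (hP : P.IsHomogeneous d) : Lorentzian d (normalizePoly P) ↔ LorentzianCoeff P := by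
  have hnonneg : ∀ α, 0 ≤ coeff α (normalizePoly P) ↔ 0 ≤ coeff α P := fun α => by
    rw [coeff_normalizePoly, le_div_iff₀ (prod_factorial_pos α), zero_mul]
  have hsupp : {α | coeff α (normalizePoly P) ≠ 0} = {α | coeff α P ≠ 0} := by
    ext α
    simp [coeff_normalizePoly, (prod_factorial_pos α).ne']
  have hhess : ∀ γ : Fin m →₀ ℕ,
      AtMostOnePosEigenvalue (hess (pderivMulti γ (normalizePoly P))) ↔
        NoPosPlane (coeffHess P γ) := fun γ => by
    rw [hess_pderivMulti_normalizePoly, atMostOnePosEigenvalue_iff (coeffHess_isSymm _ _)]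
  constructor
  · rintro ⟨-, h1, h2, h3⟩
    refine ⟨fun α => (hnonneg α).1 (h1 α), hsupp ▸ h2, fun γ => ?_⟩
    by_cases hγ : ∑ i, γ i = d - 2
    · exact (hhess γ).1 (h3 γ hγ)
    · refine noPosPlane_of_nonpos fun t => ?_
      rw [bil_eq_sum]
      refine (Finset.sum_eq_zero fun i _ => Finset.sum_eq_zero fun j _ => ?_).le
      rw [coeffHess_apply, hP.coeff_eq_zero, mul_zero]
      rw [map_add, map_add, Finsupp.degree_eq_sum, Finsupp.degree_single, Finsupp.degree_single]
      omega
  · intro h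
    refine ⟨isHomogeneous_normalizePoly hP, fun α => (hnonneg α).2 (h.nonneg α),
      hsupp ▸ h.mConvex, fun γ _ => ?_⟩
    exact (hhess (Finsupp.equivFunOnFinite.symm γ)).2 (h.noPosPlane _)

end Normalization

/-- If `N(P)` and `N(Q)` are Lorentzian, then `N(PQ)` is Lorentzian
(Brändén–Huh, Corollary 3.8). -/
theorem normalization_lorentzian_mul {m d e : ℕ}
    (P Q : MvPolynomial (Fin m) ℝ)
    (hP : P.IsHomogeneous d) (hQ : Q.IsHomogeneous e)
    (hPL : Lorentzian d (normalizePoly P)) (hQL : Lorentzian e (normalizePoly Q)) :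
    Lorentzian (d + e) (normalizePoly (P * Q)) := by
  rw [lorentzian_normalizePoly_iff hP] at hPL
  rw [lorentzian_normalizePoly_iff hQ] at hQL
  rw [lorentzian_normalizePoly_iff (hP.mul hQ)]
  exact hPL.mul hP hQ hQL
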